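/- Adaptive multi-objective loss bound (Theorem 1). Assume 0 < η ≤ 1 and 0 < γ ≤ 1/2, and let I = [r,s] with 1 ≤ r ≤ s ≤ T be an interval on which the mixture losses are nonpositive, i.e., Σ_{t=r}^{s} ⟨q^(t), ℓ^(t)⟩ ≤ 0 (as is guaranteed when each loss vector arises from a learner playing the minimax-optimal strategy against objectives satisfying the consistency assumption). Then max_{i∈L} (1/|I|)·Σ_{t=r}^{s} ℓ^(t)_i ≤ (η/|I|)·(Σ_{t=r}^{s} ⟨q^(t), (ℓ^(t))²⟩) + (1/(η|I|))·(log(|L|/γ) + 2γ|I|). -/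

import Mathlib

/-- A Fixed Share update keeps every weight at least `γ / |L|`, and the total weight equal to one. -/
theorem fixedShare_le_and_sum_eq_one {L : Type*} [Fintype L] [Nonempty L]
    {γ : ℝ} (hγ1 : γ ≤ 1) {p w p' : L → ℝ}
    (hp : ∀ i, 0 < p i) (hw : ∀ i, 0 < w i)
    (hp' : ∀ i, p' i = (1 - γ) * p i * w i / (∑ j, p j * w j) + γ / (Fintype.card L : ℝ)) :
    (∀ i, γ / (Fintype.card L : ℝ) ≤ p' i) ∧ ∑ i, p' i = 1 := by
  have hZ : 0 < ∑ j, p j * w j :=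
    Finset.sum_pos (fun j _ => mul_pos (hp j) (hw j)) Finset.univ_nonempty
  have hcard : (Fintype.card L : ℝ) ≠ 0 := by exact_mod_cast Fintype.card_ne_zero
  refine ⟨fun i => ?_, ?_⟩
  · rw [hp' i]
    have : 0 ≤ (1 - γ) * p i * w i / (∑ j, p j * w j) :=
      div_nonneg (mul_nonneg (mul_nonneg (by linarith) (hp i).le) (hw i).le) hZ.le
    linarith
  · simp_rw [hp', Finset.sum_add_distrib, mul_assoc, ← Finset.sum_div, ← Finset.mul_sum]
    rw [mul_div_assoc, div_self hZ.ne']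
    simp only [Finset.sum_const, Finset.card_univ, nsmul_eq_mul]
    field_simp
    ring

/-- The log-partition function of exponential weights is at most its second-order expansion. -/
theorem log_sum_mul_exp_le {L : Type*} [Fintype L] [Nonempty L]
    {η : ℝ} (hη0 : 0 ≤ η) (hη1 : η ≤ 1) {p l : L → ℝ}
    (hp : ∀ i, 0 < p i) (hsum : ∑ i, p i = 1) (hl : ∀ i, |l i| ≤ 1) :
    Real.log (∑ i, p i * Real.exp (η * l i)) ≤
      η * ∑ i, p i * l i + η ^ 2 * ∑ i, p i * l i ^ 2 := by
  have hZ : 0 < ∑ i, p i * Real.exp (η * l i) :=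
    Finset.sum_pos (fun i _ => mul_pos (hp i) (Real.exp_pos _)) Finset.univ_nonempty
  have hexp : ∀ i, Real.exp (η * l i) ≤ 1 + η * l i + (η * l i) ^ 2 := fun i => by
    have habs : |η * l i| ≤ 1 := by
      rw [abs_mul, abs_of_nonneg hη0]
      exact mul_le_one₀ hη1 (abs_nonneg _) (hl i)
    linarith [(abs_le.mp (Real.abs_exp_sub_one_sub_id_le habs)).2]
  calc Real.log (∑ i, p i * Real.exp (η * l i))
      ≤ ∑ i, p i * Real.exp (η * l i) - 1 := Real.log_le_sub_one_of_pos hZ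
    _ ≤ ∑ i, p i * (1 + η * l i + (η * l i) ^ 2) - 1 := by
      gcongr with i
      · exact (hp i).le
      · exact hexp i
    _ = ∑ i, (p i + η * (p i * l i) + η ^ 2 * (p i * l i ^ 2)) - 1 := by
      congr 1
      exact Finset.sum_congr rfl fun i _ => by ring
    _ = η * ∑ i, p i * l i + η ^ 2 * ∑ i, p i * l i ^ 2 := by
      rw [Finset.sum_add_distrib, Finset.sum_add_distrib, hsum, ← Finset.mul_sum,
        ← Finset.mul_sum]
      ring

theorem neg_two_mul_le_log_one_sub {γ : ℝ} (hγ0 : 0 ≤ γ) (hγ2 : γ ≤ 1 / 2) :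
    -(2 * γ) ≤ Real.log (1 - γ) := by
  have hpos : 0 < 1 - γ := by linarith
  refine le_trans ?_ (Real.one_sub_inv_le_log_of_pos hpos)
  have : (1 - γ)⁻¹ ≤ 1 + 2 * γ := by
    rw [inv_le_iff_one_le_mul₀ hpos]
    nlinarith
  linarith

/-- One Fixed Share step: the loss of a coordinate is controlled by the increase of its
log-weight, the mixture loss and the mixture of squared losses. -/
theorem fixedShare_step_le {L : Type*} [Fintype L] [Nonempty L]
    {η γ : ℝ} (hη0 : 0 ≤ η) (hη1 : η ≤ 1) (hγ0 : 0 ≤ γ) (hγ2 : γ ≤ 1 / 2) {p p' l : L → ℝ}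
    (hp : ∀ i, 0 < p i) (hsum : ∑ i, p i = 1) (hl : ∀ i, |l i| ≤ 1)
    (hp' : ∀ i, p' i = (1 - γ) * p i * Real.exp (η * l i) /
      (∑ j, p j * Real.exp (η * l j)) + γ / (Fintype.card L : ℝ)) (i : L) :
    η * l i ≤ Real.log (p' i) - Real.log (p i) + 2 * γ +
      (η * ∑ j, p j * l j + η ^ 2 * ∑ j, p j * l j ^ 2) := by
  have hZ : 0 < ∑ j, p j * Real.exp (η * l j) :=
    Finset.sum_pos (fun j _ => mul_pos (hp j) (Real.exp_pos _)) Finset.univ_nonempty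
  have hγ1 : 0 < 1 - γ := by linarith
  have hnum : 0 < (1 - γ) * p i := mul_pos hγ1 (hp i)
  have hlog := Real.log_le_log (div_pos (mul_pos hnum (Real.exp_pos (η * l i))) hZ)
    ((le_add_of_nonneg_right (by positivity)).trans_eq (hp' i).symm)
  rw [Real.log_div (mul_pos hnum (Real.exp_pos _)).ne' hZ.ne',
    Real.log_mul hnum.ne' (Real.exp_pos _).ne', Real.log_mul hγ1.ne' (hp i).ne',
    Real.log_exp] at hlog
  linarith [log_sum_mul_exp_le hη0 hη1 hp hsum hl, neg_two_mul_le_log_one_sub hγ0 hγ2]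


/-- **Adaptive multi-objective loss bound (Theorem 1).**
Assume `0 < η ≤ 1` and `0 < γ ≤ 1/2`, and let `I = [r,s]` (with `1 ≤ r ≤ s ≤ T`) be an
interval on which the mixture losses are nonpositive, `Σ_{t=r}^{s} ⟨q^(t), ℓ^(t)⟩ ≤ 0`.
Then `max_i (1/|I|)·Σ_{t=r}^{s} ℓ^(t)_i ≤ (η/|I|)·Σ_{t=r}^{s} ⟨q^(t), (ℓ^(t))²⟩
  + (1/(η|I|))·(log(|L|/γ) + 2γ|I|)`. -/
theorem adaptive_multiobjective_loss_bound
    {L : Type*} [Fintype L] [Nonempty L]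
    (T : ℕ) (hT : 1 ≤ T)
    (ℓ : ℕ → L → ℝ)
    (hℓ : ∀ t ∈ Finset.Icc 1 T, ∀ i, ℓ t i ∈ Set.Icc (-1 : ℝ) 1)
    (η γ : ℝ) (hη0 : 0 < η) (hη1 : η ≤ 1) (hγ0 : 0 < γ) (hγ2 : γ ≤ 1 / 2)
    (q : ℕ → L → ℝ)
    (hq1 : ∀ i, q 1 i = 1 / (Fintype.card L : ℝ))
    (hqrec : ∀ t ∈ Finset.Icc 1 T, ∀ i,
      q (t + 1) i = (1 - γ) * q t i * Real.exp (η * ℓ t i) /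
          (∑ j, q t j * Real.exp (η * ℓ t j)) + γ / (Fintype.card L : ℝ))
    (r s : ℕ) (hr : 1 ≤ r) (hrs : r ≤ s) (hsT : s ≤ T)
    (hmix : ∑ t ∈ Finset.Icc r s, ∑ i, q t i * ℓ t i ≤ 0) :
    (Finset.univ.sup' Finset.univ_nonempty fun i =>
        (1 / ((s : ℝ) - r + 1)) * ∑ t ∈ Finset.Icc r s, ℓ t i)
      ≤ (η / ((s : ℝ) - r + 1)) * (∑ t ∈ Finset.Icc r s, ∑ i, q t i * (ℓ t i) ^ 2)
        + (1 / (η * ((s : ℝ) - r + 1))) *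
            (Real.log ((Fintype.card L : ℝ) / γ) + 2 * γ * ((s : ℝ) - r + 1)) := by
  have hcard : 0 < (Fintype.card L : ℝ) := by exact_mod_cast Fintype.card_pos
  have hlow : 0 < γ / (Fintype.card L : ℝ) := div_pos hγ0 hcard
  have hq : ∀ t, 1 ≤ t → t ≤ T + 1 →
      (∀ i, γ / (Fintype.card L : ℝ) ≤ q t i) ∧ ∑ i, q t i = 1 := by
    intro t ht
    induction t, ht using Nat.le_induction with
    | base =>
      refine fun _ => ⟨fun i => ?_, ?_⟩
      · rw [hq1]
        gcongr
        linarith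
      · simp [hq1, hcard.ne']
    | succ t ht ih =>
      intro htT
      exact fixedShare_le_and_sum_eq_one (by linarith)
        (fun i => hlow.trans_le ((ih (by lia)).1 i)) (fun i => Real.exp_pos (η * ℓ t i))
        (hqrec t (Finset.mem_Icc.mpr ⟨ht, by lia⟩))
  have hn : 0 < (s : ℝ) - r + 1 := by
    have : (r : ℝ) ≤ s := by exact_mod_cast hrs
    linarith
  refine Finset.sup'_le _ _ fun i _ => ?_
  have hstep : ∀ t ∈ Finset.Icc r s, η * ℓ t i ≤
      (Real.log (q (t + 1) i) - Real.log (q t i)) + 2 * γ +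
        (η * ∑ j, q t j * ℓ t j + η ^ 2 * ∑ j, q t j * ℓ t j ^ 2) := by
    intro t ht
    rw [Finset.mem_Icc] at ht
    have htT : t ∈ Finset.Icc 1 T := Finset.mem_Icc.mpr ⟨by lia, by lia⟩
    obtain ⟨hqlow, hqsum⟩ := hq t (by lia) (by lia)
    exact fixedShare_step_le hη0.le hη1 hγ0.le hγ2 (fun j => hlow.trans_le (hqlow j)) hqsum
      (fun j => abs_le.mpr (hℓ t htT j)) (hqrec t htT) i
  have htele : ∑ t ∈ Finset.Icc r s, (Real.log (q (t + 1) i) - Real.log (q t i)) =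
      Real.log (q (s + 1) i) - Real.log (q r i) := by
    rw [← Finset.Ico_add_one_right_eq_Icc]
    exact Finset.sum_Ico_sub (fun t => Real.log (q t i)) (by lia)
  have hcount : ∑ _t ∈ Finset.Icc r s, 2 * γ = 2 * γ * ((s : ℝ) - r + 1) := by
    rw [Finset.sum_const, Nat.card_Icc, nsmul_eq_mul, Nat.cast_sub (by lia)]
    push_cast
    ring
  have hregret := Finset.sum_le_sum hstep
  rw [Finset.sum_add_distrib, Finset.sum_add_distrib, Finset.sum_add_distrib, htele, hcount,
    ← Finset.mul_sum, ← Finset.mul_sum, ← Finset.mul_sum] at hregret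
  have hend : Real.log (q (s + 1) i) ≤ 0 := by
    obtain ⟨hqlow, hqsum⟩ := hq (s + 1) (by lia) (by lia)
    refine Real.log_nonpos (hlow.trans_le (hqlow i)).le ?_
    rw [← hqsum]
    exact Finset.single_le_sum (fun j _ => (hlow.trans_le (hqlow j)).le) (Finset.mem_univ i)
  have hstart : -Real.log (q r i) ≤ Real.log ((Fintype.card L : ℝ) / γ) := by
    rw [← inv_div, Real.log_inv]
    exact neg_le_neg (Real.log_le_log hlow ((hq r hr (by lia)).1 i))
  have hmix' := mul_nonpos_of_nonneg_of_nonpos hη0.le hmix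
  have hrhs : η / ((s : ℝ) - r + 1) * (∑ t ∈ Finset.Icc r s, ∑ i, q t i * ℓ t i ^ 2) +
      1 / (η * ((s : ℝ) - r + 1)) *
        (Real.log ((Fintype.card L : ℝ) / γ) + 2 * γ * ((s : ℝ) - r + 1)) =
      (η ^ 2 * (∑ t ∈ Finset.Icc r s, ∑ i, q t i * ℓ t i ^ 2) +
        (Real.log ((Fintype.card L : ℝ) / γ) + 2 * γ * ((s : ℝ) - r + 1))) /
        (η * ((s : ℝ) - r + 1)) := by
    field_simp
  rw [hrhs, le_div_iff₀ (mul_pos hη0 hn)]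
  calc 1 / ((s : ℝ) - r + 1) * (∑ t ∈ Finset.Icc r s, ℓ t i) * (η * ((s : ℝ) - r + 1))
      = η * ∑ t ∈ Finset.Icc r s, ℓ t i := by field_simp
    _ ≤ _ := by linarith
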